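/- Let m ≥ 1, N > 2m, let n ≥ 1, let (e_{ij}) be a symmetric n × n matrix with entries in {0,1}, let p_{ij} ≥ 1, q_{ij} > 0, and let each Ψ_{ij} satisfy condition (K). Let (u_1, …, u_n) be a non-negative solution of the system (−Δ)^m u_i ≥ Σ_{j=1}^n e_{ij} (Ψ_{ij}(|·|) * u_j^{p_{ij}}) u_j^{q_{ij}} in ℝ^N, 1 ≤ i ≤ n. If there exist indices k, ℓ ∈ {1,…,n} (not necessarily distinct) with e_{kℓ} = e_{ℓk} = 1, p_{kℓ} + q_{kℓ} ≥ 2, p_{ℓk} + q_{ℓk} ≥ 2, and limsup_{r→∞} min{ r^{2N−(N−2m)(p_{kℓ}+q_{kℓ})} Ψ_{kℓ}(r), r^{2N−(N−2m)(p_{ℓk}+q_{ℓk})} Ψ_{ℓk}(r) } > 0, then u_k ≡ 0 and u_ℓ ≡ 0. -/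

import Mathlib

open MeasureTheory Filter Metric

/-- The Laplacian of `u : ℝ^N → ℝ`, defined via the second iterated Fréchet derivative. -/
noncomputable def lap {N : ℕ} (u : EuclideanSpace ℝ (Fin N) → ℝ) :
    EuclideanSpace ℝ (Fin N) → ℝ :=
  fun x => ∑ i : Fin N,
    iteratedFDeriv ℝ 2 u x ![EuclideanSpace.single i 1, EuclideanSpace.single i 1]

/-- `negLapPow m u = (-Δ)^m u`, the `m`-fold iterate of the negative Laplacian. -/
noncomputable def negLapPow {N : ℕ} (m : ℕ) (u : EuclideanSpace ℝ (Fin N) → ℝ) :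
    EuclideanSpace ℝ (Fin N) → ℝ :=
  (fun v => fun x => -(lap v x))^[m] u

/-- Condition (K) on the kernel `Ψ`. -/
structure CondK (N : ℕ) (Ψ : ℝ → ℝ) : Prop where
  pos : ∀ r : ℝ, 0 < r → 0 < Ψ r
  cont : ContinuousOn (fun x : EuclideanSpace ℝ (Fin N) => Ψ ‖x‖)
    {(0 : EuclideanSpace ℝ (Fin N))}ᶜ
  locInt : LocallyIntegrable (fun x : EuclideanSpace ℝ (Fin N) => Ψ ‖x‖) volume
  anti : AntitoneOn Ψ (Set.Ioi (0 : ℝ))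
  tendsto : Tendsto (fun r : ℝ => r ^ N * Ψ r) atTop atTop

section PolyharmonicCalculus

open scoped ContDiff

variable {N : ℕ}

local notation "E" => EuclideanSpace ℝ (Fin N)

theorem lap_apply (f : E → ℝ) (x : E) :
    lap f x = ∑ i : Fin N, fderiv ℝ (fderiv ℝ f) x (EuclideanSpace.single i 1)
      (EuclideanSpace.single i 1) := by
  simp [lap, iteratedFDeriv_two_apply]

theorem fderiv_fderiv_apply_const {f : E → ℝ} (hf : ContDiff ℝ 2 f) (x v w : E) :
    fderiv ℝ (fun y => fderiv ℝ f y v) x w = fderiv ℝ (fderiv ℝ f) x w v := by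
  have h : DifferentiableAt ℝ (fderiv ℝ f) x :=
    ((hf.fderiv_right (m := 1) (by norm_num)).differentiable (by norm_num)).differentiableAt
  rw [fderiv_clm_apply h (differentiableAt_const v)]
  simp

theorem lap_eq_sum {f : E → ℝ} (hf : ContDiff ℝ 2 f) (x : E) :
    lap f x = ∑ i : Fin N, fderiv ℝ (fun y => fderiv ℝ f y (EuclideanSpace.single i 1)) x
      (EuclideanSpace.single i 1) := by
  simp_rw [lap_apply, fderiv_fderiv_apply_const hf]

theorem ContDiff.lap {f : E → ℝ} {n k : WithTop ℕ∞} (hf : ContDiff ℝ n f) (h : k + 2 ≤ n) :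
    ContDiff ℝ k (lap f) := by
  have h2 : k + 1 + 1 ≤ n := by rwa [add_assoc, one_add_one_eq_two]
  have h1 : ContDiff ℝ k (fderiv ℝ (fderiv ℝ f)) :=
    (hf.fderiv_right (m := k + 1) h2).fderiv_right le_rfl
  have : _root_.lap f = fun x => ∑ i : Fin N, fderiv ℝ (fderiv ℝ f) x (EuclideanSpace.single i 1)
      (EuclideanSpace.single i 1) := funext (lap_apply f)
  rw [this]
  exact ContDiff.sum fun i _ => (h1.clm_apply contDiff_const).clm_apply contDiff_const

theorem contDiff_fderiv_apply {f : E → ℝ} {n k : WithTop ℕ∞} (hf : ContDiff ℝ n f)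
    (h : k + 1 ≤ n) (v : E) : ContDiff ℝ k (fun y => fderiv ℝ f y v) :=
  (hf.fderiv_right h).clm_apply contDiff_const

theorem lap_congr_of_isOpen {f g : E → ℝ} {s : Set E} (hs : IsOpen s) (h : Set.EqOn f g s) :
    Set.EqOn (lap f) (lap g) s := by
  intro x hx
  have h1 : f =ᶠ[nhds x] g := h.eventuallyEq_of_mem (hs.mem_nhds hx)
  simp only [lap_apply, (h1.fderiv).fderiv_eq]

theorem lap_add {f g : E → ℝ} (hf : ContDiff ℝ 2 f) (hg : ContDiff ℝ 2 g) (x : E) :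
    lap (fun y => f y + g y) x = lap f x + lap g x := by
  have h1 : fderiv ℝ (fun y => f y + g y) = fun y => fderiv ℝ f y + fderiv ℝ g y := by
    funext y
    exact fderiv_fun_add (hf.differentiable (by norm_num) y) (hg.differentiable (by norm_num) y)
  have df : Differentiable ℝ (fderiv ℝ f) :=
    (hf.fderiv_right (m := 1) (by norm_num)).differentiable (by norm_num)
  have dg : Differentiable ℝ (fderiv ℝ g) :=
    (hg.fderiv_right (m := 1) (by norm_num)).differentiable (by norm_num)
  simp only [lap_apply, h1, fderiv_fun_add (df x) (dg x), ← Finset.sum_add_distrib]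
  rfl

theorem lap_const_mul (f : E → ℝ) (c : ℝ) (x : E) :
    lap (fun y => c * f y) x = c * lap f x := by
  have h1 : fderiv ℝ (fun y => c * f y) = c • fderiv ℝ f := fderiv_const_smul_field (f := f) c
  have h2 : fderiv ℝ (c • fderiv ℝ f) = c • fderiv ℝ (fderiv ℝ f) :=
    fderiv_const_smul_field (𝕜 := ℝ) (F := E →L[ℝ] ℝ) (f := fderiv ℝ f) (R := ℝ) c
  simp only [lap_apply, h1, h2, Finset.mul_sum]
  rfl

theorem lap_mul {f g : E → ℝ} (hf : ContDiff ℝ 2 f) (hg : ContDiff ℝ 2 g) (x : E) :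
    lap (fun y => f y * g y) x = f x * lap g x + lap f x * g x +
      2 * ∑ i : Fin N, fderiv ℝ f x (EuclideanSpace.single i 1) *
        fderiv ℝ g x (EuclideanSpace.single i 1) := by
  have df : Differentiable ℝ f := hf.differentiable (by norm_num)
  have dg : Differentiable ℝ g := hg.differentiable (by norm_num)
  rw [lap_eq_sum (hf.mul hg), lap_eq_sum hf, lap_eq_sum hg, Finset.mul_sum, Finset.sum_mul,
    Finset.mul_sum, ← Finset.sum_add_distrib, ← Finset.sum_add_distrib]
  refine Finset.sum_congr rfl fun i _ => ?_
  set v : E := EuclideanSpace.single i 1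
  have d1f : Differentiable ℝ (fun y => fderiv ℝ f y v) :=
    (contDiff_fderiv_apply hf (k := 1) (by norm_num) v).differentiable (by norm_num)
  have d1g : Differentiable ℝ (fun y => fderiv ℝ g y v) :=
    (contDiff_fderiv_apply hg (k := 1) (by norm_num) v).differentiable (by norm_num)
  have h1 : (fun y => fderiv ℝ (fun y => f y * g y) y v) =
      fun y => f y * fderiv ℝ g y v + g y * fderiv ℝ f y v := by
    funext y
    rw [fderiv_fun_mul (df y) (dg y)]
    simp
  rw [h1, fderiv_fun_add ((df x).fun_mul (d1g x)) ((dg x).fun_mul (d1f x)), fderiv_fun_mul (df x) (d1g x),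
    fderiv_fun_mul (dg x) (d1f x)]
  simp
  ring

theorem lap_comp_add_smul (f : E → ℝ) (a : E) (r : ℝ) (z : E) :
    lap (fun y => f (a + r • y)) z = r ^ 2 * lap f (a + r • z) := by
  have h1 : ∀ {F : Type} [NormedAddCommGroup F] [NormedSpace ℝ F] (g : E → F),
      fderiv ℝ (fun y => g (a + r • y)) = fun y => r • fderiv ℝ g (a + r • y) := by
    intro F _ _ g
    funext y
    rw [fderiv_comp_smul (f := fun y => g (a + y)), fderiv_comp_add_left]
  have h2 : fderiv ℝ (fun y => r • fderiv ℝ f (a + r • y)) z =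
      r • r • fderiv ℝ (fderiv ℝ f) (a + r • z) := by
    have h3 := fderiv_const_smul_field (𝕜 := ℝ) (f := fun y => fderiv ℝ f (a + r • y)) r
    rw [h1] at h3
    exact congrFun h3 z
  simp only [lap_apply, h1 f, h2, Finset.mul_sum]
  refine Finset.sum_congr rfl fun i _ => ?_
  simp
  ring

theorem integral_mul_lap_comm {v φ : E → ℝ} (hv : ContDiff ℝ 2 v) (hφ : ContDiff ℝ 2 φ)
    (hc : HasCompactSupport φ) : ∫ x, v x * lap φ x = ∫ x, lap v x * φ x := by
  have cs1 : ∀ w : E, HasCompactSupport (fun y => fderiv ℝ φ y w) := fun w =>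
    hc.fderiv_apply ℝ w
  have key : ∀ i : Fin N,
      (∫ x, v x * fderiv ℝ (fun y => fderiv ℝ φ y (EuclideanSpace.single i 1)) x
        (EuclideanSpace.single i 1)) =
      ∫ x, fderiv ℝ (fun y => fderiv ℝ v y (EuclideanSpace.single i 1)) x
        (EuclideanSpace.single i 1) * φ x := by
    intro i
    set w : E := EuclideanSpace.single i 1
    have c1φ := contDiff_fderiv_apply hφ (k := 1) (by norm_num) w
    have c1v := contDiff_fderiv_apply hv (k := 1) (by norm_num) w
    have c2φ := contDiff_fderiv_apply c1φ (k := 0) (by norm_num) w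
    have c2v := contDiff_fderiv_apply c1v (k := 0) (by norm_num) w
    have dφ := hφ.differentiable (by norm_num)
    have dv := hv.differentiable (by norm_num)
    rw [integral_mul_fderiv_eq_neg_fderiv_mul_of_integrable
        ((c1v.continuous.mul c1φ.continuous).integrable_of_hasCompactSupport (cs1 w).mul_left)
        ((hv.continuous.mul c2φ.continuous).integrable_of_hasCompactSupport
          ((cs1 w).fderiv_apply ℝ w).mul_left)
        ((hv.continuous.mul c1φ.continuous).integrable_of_hasCompactSupport (cs1 w).mul_left)
        (fun x _ => dv x) (fun x _ => c1φ.differentiable (by norm_num) x),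
      integral_mul_fderiv_eq_neg_fderiv_mul_of_integrable
        ((c2v.continuous.mul hφ.continuous).integrable_of_hasCompactSupport hc.mul_left)
        ((c1v.continuous.mul c1φ.continuous).integrable_of_hasCompactSupport (cs1 w).mul_left)
        ((c1v.continuous.mul hφ.continuous).integrable_of_hasCompactSupport hc.mul_left)
        (fun x _ => c1v.differentiable (by norm_num) x) (fun x _ => dφ x), neg_neg]
  simp_rw [lap_eq_sum hv, lap_eq_sum hφ, Finset.mul_sum, Finset.sum_mul]
  rw [integral_finsetSum, integral_finsetSum]
  · exact Finset.sum_congr rfl fun i _ => key i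
  · intro i _
    have c2v := contDiff_fderiv_apply (contDiff_fderiv_apply hv (k := 1) (by norm_num)
      (EuclideanSpace.single i 1)) (k := 0) (by norm_num) (EuclideanSpace.single i 1)
    exact (c2v.continuous.mul hφ.continuous).integrable_of_hasCompactSupport hc.mul_left
  · intro i _
    have c2φ := contDiff_fderiv_apply (contDiff_fderiv_apply hφ (k := 1) (by norm_num)
      (EuclideanSpace.single i 1)) (k := 0) (by norm_num) (EuclideanSpace.single i 1)
    exact (hv.continuous.mul c2φ.continuous).integrable_of_hasCompactSupport
      ((cs1 _).fderiv_apply ℝ _).mul_left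

theorem HasCompactSupport.lap {f : E → ℝ} (hf : HasCompactSupport f) :
    HasCompactSupport (lap f) := by
  refine hf.mono' ?_
  intro x hx
  by_contra hx'
  apply hx
  have : f =ᶠ[nhds x] fun _ => 0 := notMem_tsupport_iff_eventuallyEq.mp hx'
  simp [lap_apply, this.fderiv.fderiv_eq]

theorem negLapPow_succ (m : ℕ) (f : E → ℝ) :
    negLapPow (m + 1) f = negLapPow m (fun x => -(lap f x)) := by
  simp [negLapPow]

theorem negLapPow_succ' (m : ℕ) (f : E → ℝ) :
    negLapPow (m + 1) f = fun x => -(lap (negLapPow m f) x) := by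
  simp only [negLapPow, Function.iterate_succ_apply']

theorem ContDiff.negLapPow {f : E → ℝ} (hf : ContDiff ℝ ∞ f) (m : ℕ) :
    ContDiff ℝ ∞ (negLapPow m f) := by
  induction m with
  | zero => exact hf
  | succ m ih => rw [negLapPow_succ']; exact (ih.lap le_rfl).neg

theorem HasCompactSupport.negLapPow {f : E → ℝ} (hf : HasCompactSupport f) (m : ℕ) :
    HasCompactSupport (negLapPow m f) := by
  induction m with
  | zero => exact hf
  | succ m ih => rw [negLapPow_succ']; exact ih.lap.neg

theorem contDiff_two_neg_lap {m : ℕ} {f : E → ℝ}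
    (hf : ContDiff ℝ (2 * (m + 1 : ℕ)) f) : ContDiff ℝ (2 * m) (fun x => -(lap f x)) := by
  refine (hf.lap ?_).neg
  push_cast
  rw [mul_add, mul_one]

theorem continuous_negLapPow {m : ℕ} {f : E → ℝ} (hf : ContDiff ℝ (2 * m) f) :
    Continuous (negLapPow m f) := by
  induction m generalizing f with
  | zero => exact hf.continuous
  | succ m ih => rw [negLapPow_succ]; exact ih (contDiff_two_neg_lap hf)

theorem negLapPow_add {f g : E → ℝ} (hf : ContDiff ℝ ∞ f) (hg : ContDiff ℝ ∞ g) (m : ℕ) (x : E) :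
    negLapPow m (fun y => f y + g y) x = negLapPow m f x + negLapPow m g x := by
  induction m generalizing x with
  | zero => rfl
  | succ m ih =>
    simp only [negLapPow_succ', funext ih]
    rw [lap_add ((hf.negLapPow m).of_le ENat.LEInfty.out)
      ((hg.negLapPow m).of_le ENat.LEInfty.out)]
    ring

theorem negLapPow_const_mul (f : E → ℝ) (c : ℝ) (m : ℕ) (x : E) :
    negLapPow m (fun y => c * f y) x = c * negLapPow m f x := by
  induction m generalizing x with
  | zero => rfl
  | succ m ih =>
    simp only [negLapPow_succ', funext ih]
    rw [lap_const_mul]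
    ring

theorem negLapPow_congr_of_isOpen {f g : E → ℝ} {s : Set E} (hs : IsOpen s)
    (h : Set.EqOn f g s) (m : ℕ) : Set.EqOn (negLapPow m f) (negLapPow m g) s := by
  induction m with
  | zero => exact h
  | succ m ih =>
    simp only [negLapPow_succ']
    intro x hx
    simp only [lap_congr_of_isOpen hs ih hx]

theorem negLapPow_comp_add_smul (f : E → ℝ) (a : E) (r : ℝ) (m : ℕ) (z : E) :
    negLapPow m (fun y => f (a + r • y)) z = r ^ (2 * m) * negLapPow m f (a + r • z) := by
  induction m generalizing z with
  | zero => simp [negLapPow]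
  | succ m ih =>
    simp only [negLapPow_succ', funext ih]
    rw [lap_const_mul, lap_comp_add_smul]
    ring

theorem integral_mul_negLapPow_comm {m : ℕ} {v φ : E → ℝ} (hv : ContDiff ℝ (2 * m) v)
    (hφ : ContDiff ℝ ∞ φ) (hc : HasCompactSupport φ) :
    ∫ x, negLapPow m v x * φ x = ∫ x, v x * negLapPow m φ x := by
  induction m generalizing v with
  | zero => rfl
  | succ m ih =>
    rw [negLapPow_succ, ih (contDiff_two_neg_lap hv), negLapPow_succ']
    simp only [neg_mul, mul_neg, integral_neg]
    rw [integral_mul_lap_comm (hv.of_le ?_) ((hφ.negLapPow m).of_le ENat.LEInfty.out)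
      (hc.negLapPow m)]
    push_cast
    rw [mul_add, mul_one]
    exact le_add_self

end PolyharmonicCalculus

section Bubble

open scoped ContDiff

variable {N : ℕ}

local notation "E" => EuclideanSpace ℝ (Fin N)

/-- The power `(δ² + |z|²)^a` of the regularised squared norm. -/
noncomputable def bubble (δ a : ℝ) (z : EuclideanSpace ℝ (Fin N)) : ℝ :=
  (δ ^ 2 + ‖z‖ ^ 2) ^ a

theorem bubble_base_pos {δ : ℝ} (hδ : 0 < δ) (z : E) : 0 < δ ^ 2 + ‖z‖ ^ 2 := by positivity

theorem bubble_pos {δ : ℝ} (hδ : 0 < δ) (a : ℝ) (z : E) : 0 < bubble δ a z :=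
  Real.rpow_pos_of_pos (bubble_base_pos hδ z) a

theorem bubble_sub_one_mul {δ : ℝ} (hδ : 0 < δ) (a : ℝ) (z : E) :
    bubble δ (a - 1) z * (δ ^ 2 + ‖z‖ ^ 2) = bubble δ a z := by
  rw [bubble, bubble, Real.rpow_sub_one (bubble_base_pos hδ z).ne']
  field_simp [(bubble_base_pos hδ z).ne']

theorem contDiff_bubble {δ : ℝ} (hδ : 0 < δ) (a : ℝ) :
    ContDiff ℝ ∞ (bubble δ a : E → ℝ) :=
  (contDiff_const.add (contDiff_norm_sq ℝ)).rpow_const_of_ne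
    fun z => (bubble_base_pos hδ z).ne'

theorem fderiv_bubble {δ : ℝ} (hδ : 0 < δ) (a : ℝ) (z v : E) :
    fderiv ℝ (bubble δ a) z v = 2 * a * (bubble δ (a - 1) z * inner ℝ z v) := by
  have h : HasFDerivAt (fun y : E => δ ^ 2 + ‖y‖ ^ 2) (2 • innerSL ℝ z) z :=
    (hasStrictFDerivAt_norm_sq z).hasFDerivAt.const_add _
  have h2 : HasFDerivAt (bubble δ a : E → ℝ) _ z :=
    h.rpow_const (p := a) (Or.inl (bubble_base_pos hδ z).ne')
  rw [h2.fderiv]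
  simp [bubble]
  ring

theorem fderiv_bubble_single {δ : ℝ} (hδ : 0 < δ) (a : ℝ) (z : E) (i : Fin N) :
    fderiv ℝ (bubble δ a) z (EuclideanSpace.single i 1) = 2 * a * (bubble δ (a - 1) z * z i) := by
  rw [fderiv_bubble hδ, EuclideanSpace.inner_single_right]
  simp

theorem fderiv_coord_single (z : E) (i : Fin N) :
    fderiv ℝ (fun y : E => y i) z (EuclideanSpace.single i 1) = 1 := by
  have : (fun y : E => y i) = (EuclideanSpace.proj i : E →L[ℝ] ℝ) := by
    funext y; simp
  rw [this, ContinuousLinearMap.fderiv]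
  simp

theorem lap_bubble_eq_norm {δ : ℝ} (hδ : 0 < δ) (a : ℝ) (z : E) :
    lap (bubble δ a) z =
      2 * a * N * bubble δ (a - 1) z + 4 * a * (a - 1) * (bubble δ (a - 2) z * ‖z‖ ^ 2) := by
  rw [lap_eq_sum ((contDiff_bubble hδ a).of_le ENat.LEInfty.out)]
  have key : ∀ i : Fin N, fderiv ℝ (fun y : E => fderiv ℝ (bubble δ a) y
      (EuclideanSpace.single i 1)) z (EuclideanSpace.single i 1) =
      2 * a * bubble δ (a - 1) z + 4 * a * (a - 1) * bubble δ (a - 2) z * z i ^ 2 := by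
    intro i
    have d1 : DifferentiableAt ℝ (bubble δ (a - 1) : E → ℝ) z :=
      (contDiff_bubble hδ (a - 1)).differentiable (by norm_num) z
    have d2 : DifferentiableAt ℝ (fun y : E => y i) z := by fun_prop
    simp only [fderiv_bubble_single hδ]
    rw [fderiv_const_mul (d1.fun_mul d2), fderiv_fun_mul d1 d2]
    simp only [add_apply, smul_apply, smul_eq_mul,
      fderiv_coord_single, fderiv_bubble_single hδ]
    rw [show a - 1 - 1 = a - 2 by ring]
    ring
  simp only [key, Finset.sum_add_distrib, ← Finset.mul_sum, EuclideanSpace.norm_sq_eq,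
    Real.norm_eq_abs, sq_abs]
  simp
  ring

theorem neg_lap_bubble {δ : ℝ} (hδ : 0 < δ) (b : ℝ) (z : E) :
    -(lap (bubble δ (-b)) z) = 2 * b * (N - 2 * b - 2) * bubble δ (-(b + 1)) z +
      4 * b * (b + 1) * δ ^ 2 * bubble δ (-(b + 2)) z := by
  rw [lap_bubble_eq_norm hδ]
  have h := bubble_sub_one_mul hδ (-(b + 1)) z
  rw [show -b - 1 = -(b + 1) by ring, show -b - 2 = -(b + 2) by ring]
  rw [show -(b + 1) - 1 = -(b + 2) by ring] at h
  rw [← h]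
  ring

/-- The constant in `(-Δ)^m (δ² + |z|²)^(-(N/2-m)) = c δ^(2m) (δ² + |z|²)^(-(N/2+m))`. -/
noncomputable def bubbleConst (N : ℕ) : ℕ → ℝ
  | 0 => 1
  | m + 1 => bubbleConst N m * (4 * ((N : ℝ) / 2 - m - 1) * ((N : ℝ) / 2 + m))

theorem bubbleConst_pos {N m : ℕ} (h : 2 * m < N) : 0 < bubbleConst N m := by
  induction m with
  | zero => exact one_pos
  | succ m ih =>
    have h1 : (2 : ℝ) * (m + 1) < N := by exact_mod_cast h
    have h2 : (0 : ℝ) ≤ m := m.cast_nonneg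
    have h3 := ih (by omega)
    rw [bubbleConst]
    refine mul_pos h3 (mul_pos (mul_pos (by norm_num) ?_) ?_) <;> linarith

theorem negLapPow_bubble {δ : ℝ} (hδ : 0 < δ) (m : ℕ) (z : E) :
    negLapPow m (bubble δ (-((N : ℝ) / 2 - m))) z =
      bubbleConst N m * δ ^ (2 * m) * bubble δ (-((N : ℝ) / 2 + m)) z := by
  induction m using Nat.twoStepInduction generalizing z with
  | zero => simp [negLapPow, bubbleConst]
  | one =>
    rw [negLapPow_succ']
    simp only [negLapPow, Function.iterate_zero, id]
    rw [neg_lap_bubble hδ]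
    have h1 : (N : ℝ) / 2 - (1 : ℕ) + 2 = (N : ℝ) / 2 + (1 : ℕ) := by push_cast; ring
    rw [h1]
    simp only [bubbleConst]
    push_cast
    ring
  | more m ih0 ih1 =>
    have e : (fun x : E => -(lap (bubble δ (-((N : ℝ) / 2 - (m + 2 : ℕ)))) x)) =
        fun x => 4 * ((N : ℝ) / 2 - m - 2) * (m + 1) * bubble δ (-((N : ℝ) / 2 - (m + 1 : ℕ))) x +
          4 * ((N : ℝ) / 2 - m - 2) * ((N : ℝ) / 2 - m - 1) * δ ^ 2 *
            bubble δ (-((N : ℝ) / 2 - m)) x := by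
      funext x
      rw [neg_lap_bubble hδ]
      have h1 : (N : ℝ) / 2 - (m + 2 : ℕ) + 1 = (N : ℝ) / 2 - (m + 1 : ℕ) := by push_cast; ring
      have h2 : (N : ℝ) / 2 - (m + 2 : ℕ) + 2 = (N : ℝ) / 2 - m := by push_cast; ring
      rw [h1, h2]
      push_cast
      ring
    have h0 : negLapPow (m + 1) (bubble δ (-((N : ℝ) / 2 - m))) z =
        bubbleConst N m * δ ^ (2 * m) *
          (-4 * ((N : ℝ) / 2 + m) * (m + 1) * bubble δ (-((N : ℝ) / 2 + (m + 1 : ℕ))) z +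
          4 * ((N : ℝ) / 2 + m) * ((N : ℝ) / 2 + m + 1) * δ ^ 2 *
            bubble δ (-((N : ℝ) / 2 + (m + 2 : ℕ))) z) := by
      rw [negLapPow_succ']
      simp only [funext ih0]
      rw [lap_const_mul, ← mul_neg, neg_lap_bubble hδ]
      have h1 : (N : ℝ) / 2 + m + 1 = (N : ℝ) / 2 + (m + 1 : ℕ) := by push_cast; ring
      have h2 : (N : ℝ) / 2 + m + 2 = (N : ℝ) / 2 + (m + 2 : ℕ) := by push_cast; ring
      rw [h1, h2]
      push_cast
      ring
    rw [negLapPow_succ, e, negLapPow_add (contDiff_const.mul (contDiff_bubble hδ _))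
      (contDiff_const.mul (contDiff_bubble hδ _)), negLapPow_const_mul, negLapPow_const_mul,
      ih1, h0]
    simp only [bubbleConst]
    push_cast
    ring

theorem neg_lap_bubble_mul {δ : ℝ} (hδ : 0 < δ) (a : ℝ) {h : E → ℝ} (hh : ContDiff ℝ ∞ h) (z : E) :
    -(lap (fun y => bubble δ a y * h y) z) = bubble δ a z * (-(lap h z)) +
      (bubble δ (a - 1) z * (-(2 * a * N * h z +
        4 * a * ∑ i : Fin N, z i * fderiv ℝ h z (EuclideanSpace.single i 1))) +
      bubble δ (a - 2) z * (-(4 * a * (a - 1) * (‖z‖ ^ 2 * h z)))) := by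
  rw [lap_mul ((contDiff_bubble hδ a).of_le ENat.LEInfty.out) (hh.of_le ENat.LEInfty.out),
    lap_bubble_eq_norm hδ]
  simp only [fderiv_bubble_single hδ]
  have : ∑ i : Fin N, 2 * a * (bubble δ (a - 1) z * z i) *
      fderiv ℝ h z (EuclideanSpace.single i 1) = 2 * a * bubble δ (a - 1) z *
      ∑ i : Fin N, z i * fderiv ℝ h z (EuclideanSpace.single i 1) := by
    rw [Finset.mul_sum]
    exact Finset.sum_congr rfl fun i _ => by ring
  rw [this]
  ring

theorem exists_bound_bubble_mul (a : ℝ) {h : E → ℝ} (hh : Continuous h)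
    (hc : HasCompactSupport h) :
    ∃ C : ℝ, ∀ δ : ℝ, 0 < δ → δ ≤ 1 → ∀ z : E, 1 ≤ ‖z‖ → |bubble δ a z * h z| ≤ C := by
  obtain ⟨M, hM⟩ := hc.exists_bound_of_continuous hh
  obtain ⟨R, hR⟩ := hc.isCompact.isBounded.subset_closedBall 0
  refine ⟨(1 + R ^ 2) ^ |a| * M, fun δ hδ hδ1 z hz => ?_⟩
  by_cases hz0 : h z = 0
  · have : 0 ≤ M := (norm_nonneg _).trans (hM z)
    rw [hz0, mul_zero, abs_zero]
    positivity
  · have hzR : ‖z‖ ≤ R := by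
      simpa using hR (subset_tsupport _ hz0)
    have h1 : 1 ≤ δ ^ 2 + ‖z‖ ^ 2 := by nlinarith
    have h2 : δ ^ 2 + ‖z‖ ^ 2 ≤ 1 + R ^ 2 := by nlinarith
    have h3 : bubble δ a z ≤ (1 + R ^ 2) ^ |a| :=
      (Real.rpow_le_rpow_of_exponent_le h1 (le_abs_self a)).trans
        (Real.rpow_le_rpow (by linarith) h2 (abs_nonneg a))
    rw [abs_mul, abs_of_pos (bubble_pos hδ a z)]
    exact mul_le_mul h3 (hM z) (abs_nonneg _) (by positivity)

theorem exists_bound_negLapPow_bubble_mul (k : ℕ) (a : ℝ) {h : E → ℝ} (hh : ContDiff ℝ ∞ h)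
    (hc : HasCompactSupport h) :
    ∃ C : ℝ, ∀ δ : ℝ, 0 < δ → δ ≤ 1 → ∀ z : E, 1 ≤ ‖z‖ →
      |negLapPow k (fun y => bubble δ a y * h y) z| ≤ C := by
  induction k generalizing a h with
  | zero => exact exists_bound_bubble_mul a hh.continuous hc
  | succ k ih =>
    set h1 : E → ℝ := fun z => -(lap h z)
    set h2 : E → ℝ := fun z => -(2 * a * N * h z +
      4 * a * ∑ i : Fin N, z i * fderiv ℝ h z (EuclideanSpace.single i 1))
    set h3 : E → ℝ := fun z => -(4 * a * (a - 1) * (‖z‖ ^ 2 * h z))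
    have s1 : ContDiff ℝ ∞ h1 := (hh.lap le_rfl).neg
    have s2 : ContDiff ℝ ∞ h2 := by
      refine ((contDiff_const.mul hh).add (contDiff_const.mul (ContDiff.sum fun i _ => ?_))).neg
      exact ContDiff.mul (by fun_prop) (contDiff_fderiv_apply hh le_rfl _)
    have s3 : ContDiff ℝ ∞ h3 := (contDiff_const.mul ((contDiff_norm_sq ℝ).mul hh)).neg
    have k1 : HasCompactSupport h1 := hc.lap.neg
    have k3 : HasCompactSupport h3 := hc.mono fun z hz hz0 => hz (by simp [h3, hz0])
    have k2 : HasCompactSupport h2 := by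
      refine hc.mono' fun z hz => ?_
      by_contra hz0
      apply hz
      have e0 : h =ᶠ[nhds z] fun _ => 0 := notMem_tsupport_iff_eventuallyEq.mp hz0
      simp [h2, e0.fderiv_eq, e0.self_of_nhds]
    obtain ⟨C1, hC1⟩ := ih a s1 k1
    obtain ⟨C2, hC2⟩ := ih (a - 1) s2 k2
    obtain ⟨C3, hC3⟩ := ih (a - 2) s3 k3
    refine ⟨C1 + (C2 + C3), fun δ hδ hδ1 z hz => ?_⟩
    rw [negLapPow_succ]
    simp only [neg_lap_bubble_mul hδ a hh]
    rw [negLapPow_add (f := fun z => bubble δ a z * h1 z)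
        (g := fun z => bubble δ (a - 1) z * h2 z + bubble δ (a - 2) z * h3 z)
        ((contDiff_bubble hδ _).mul s1)
        (((contDiff_bubble hδ _).mul s2).add ((contDiff_bubble hδ _).mul s3)),
      negLapPow_add (f := fun z => bubble δ (a - 1) z * h2 z)
        (g := fun z => bubble δ (a - 2) z * h3 z)
        ((contDiff_bubble hδ _).mul s2) ((contDiff_bubble hδ _).mul s3)]
    exact (abs_add_le _ _).trans (add_le_add (hC1 δ hδ hδ1 z hz)
      ((abs_add_le _ _).trans (add_le_add (hC2 δ hδ hδ1 z hz) (hC3 δ hδ hδ1 z hz))))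

end Bubble

section LowerBound

open scoped ContDiff Topology

variable {N : ℕ}

local notation "E" => EuclideanSpace ℝ (Fin N)

theorem integrableOn_closedBall_of_continuous {f : E → ℝ} (hf : Continuous f) (x : E) (r : ℝ) :
    IntegrableOn f (closedBall x r) :=
  hf.continuousOn.integrableOn_compact (isCompact_closedBall x r)

theorem exists_setIntegral_negLapPow_le_bubble {m : ℕ} (hN : 2 * m < N) :
    ∃ C : ℝ, 0 ≤ C ∧ ∀ v : E → ℝ, ContDiff ℝ (2 * m) v → (∀ x, 0 ≤ v x) →
      (∀ x, 0 ≤ negLapPow m v x) → ∀ r δ : ℝ, 0 < δ → δ ≤ r → r ≤ 1 →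
      (2 * r ^ 2) ^ (-((N : ℝ) / 2 - m)) * ∫ z in ball 0 r, negLapPow m v z ≤
        bubbleConst N m * (∫ z in ball 0 1, δ ^ (2 * m) * bubble δ (-((N : ℝ) / 2 + m)) z * v z) +
          C * ∫ z in closedBall 0 2 \ ball 0 1, v z := by
  set b : ℝ := (N : ℝ) / 2 - m with hb
  have hb0 : 0 < b := by
    have : (2 : ℝ) * m < N := by exact_mod_cast hN
    rw [hb]; linarith
  set χ : ContDiffBump (0 : E) := ⟨1, 2, by norm_num, by norm_num⟩
  have hχs : ContDiff ℝ ∞ (χ : E → ℝ) := χ.contDiff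
  obtain ⟨C, hC⟩ := exists_bound_negLapPow_bubble_mul m (-b) hχs χ.hasCompactSupport
  refine ⟨max C 0, le_max_right _ _, fun v hv hv0 hmu r δ hδ hδr hr => ?_⟩
  have hr0 : 0 < r := hδ.trans_le hδr
  set φ : E → ℝ := fun z => bubble δ (-b) z * χ z with hφ
  have hφs : ContDiff ℝ ∞ φ := (contDiff_bubble hδ _).mul hχs
  have hφc : HasCompactSupport φ := χ.hasCompactSupport.mul_left
  have hφ0 : ∀ z, 0 ≤ φ z := fun z => mul_nonneg (bubble_pos hδ _ z).le χ.nonneg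
  have hmuc : Continuous (negLapPow m v) := continuous_negLapPow hv
  have ibp := integral_mul_negLapPow_comm hv hφs hφc
  have hi1 : Integrable (fun x => negLapPow m v x * φ x) :=
    (hmuc.mul hφs.continuous).integrable_of_hasCompactSupport hφc.mul_left
  have hi2 : Integrable (fun x => v x * negLapPow m φ x) :=
    (hv.continuous.mul (hφs.negLapPow m).continuous).integrable_of_hasCompactSupport
      (hφc.negLapPow m).mul_left
  have hχ1 : ∀ z ∈ ball (0 : E) 1, χ z = 1 := fun z hz =>
    χ.one_of_mem_closedBall (ball_subset_closedBall hz)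
  have lower : (2 * r ^ 2) ^ (-b) * ∫ z in ball 0 r, negLapPow m v z ≤
      ∫ x, negLapPow m v x * φ x := by
    rw [← integral_const_mul]
    refine le_trans ?_ (setIntegral_le_integral (s := ball 0 r) hi1
      (Eventually.of_forall fun x => mul_nonneg (hmu x) (hφ0 x)))
    refine setIntegral_mono_on ?_ hi1.integrableOn measurableSet_ball fun z hz => ?_
    · exact ((integrableOn_closedBall_of_continuous hmuc 0 r).mono_set
        ball_subset_closedBall).const_mul _
    · rw [mul_comm]
      refine mul_le_mul_of_nonneg_left ?_ (hmu z)
      have hz' : ‖z‖ < r := by simpa using hz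
      simp only [hφ]
      rw [hχ1 z (ball_subset_ball hr hz), mul_one]
      refine Real.rpow_le_rpow_of_nonpos (bubble_base_pos hδ z) ?_ (by linarith)
      nlinarith [norm_nonneg z]
  have inner_eq : ∀ z ∈ ball (0 : E) 1, negLapPow m φ z =
      bubbleConst N m * (δ ^ (2 * m) * bubble δ (-((N : ℝ) / 2 + m)) z) := by
    intro z hz
    rw [negLapPow_congr_of_isOpen isOpen_ball (f := φ) (g := bubble δ (-b)) ?_ m hz,
      negLapPow_bubble hδ, mul_assoc]
    intro y hy
    simp only [hφ]
    rw [hχ1 y hy, mul_one]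
  have outer_zero : ∀ z ∈ (closedBall (0 : E) 2)ᶜ, negLapPow m φ z = 0 := by
    intro z hz
    rw [negLapPow_congr_of_isOpen isClosed_closedBall.isOpen_compl (f := φ)
      (g := fun y => 0 * φ y) ?_ m hz, negLapPow_const_mul, zero_mul]
    intro y hy
    have : χ y = 0 := χ.zero_of_le_dist (by simpa using (not_le.1 (by simpa using hy)).le)
    simp [hφ, this]
  have hvann : IntegrableOn v (closedBall (0 : E) 2 \ ball 0 1) :=
    (integrableOn_closedBall_of_continuous hv.continuous 0 2).mono_set Set.sdiff_subset
  have mann : MeasurableSet (closedBall (0 : E) 2 \ ball 0 1) :=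
    measurableSet_closedBall.diff measurableSet_ball
  have outer : ∫ x in (ball (0 : E) 1)ᶜ, v x * negLapPow m φ x ≤
      max C 0 * ∫ z in closedBall 0 2 \ ball 0 1, v z := by
    have e1 : ∫ x in (ball (0 : E) 1)ᶜ, v x * negLapPow m φ x =
        ∫ x in closedBall 0 2 \ ball 0 1, v x * negLapPow m φ x := by
      refine setIntegral_eq_of_subset_of_forall_sdiff_eq_zero measurableSet_ball.compl
        (fun x hx => hx.2) fun x hx => ?_
      rw [outer_zero x fun h => hx.2 ⟨h, hx.1⟩, mul_zero]
    rw [e1, ← integral_const_mul]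
    refine setIntegral_mono_on hi2.integrableOn (hvann.const_mul _) mann fun z hz => ?_
    rw [mul_comm]
    refine mul_le_mul_of_nonneg_right ?_ (hv0 z)
    have hz1 : 1 ≤ ‖z‖ := by simpa using hz.2
    exact (le_abs_self _).trans ((hC δ hδ (hδr.trans hr) z hz1).trans (le_max_left _ _))
  have inner : ∫ x in ball (0 : E) 1, v x * negLapPow m φ x = bubbleConst N m *
      ∫ z in ball 0 1, δ ^ (2 * m) * bubble δ (-((N : ℝ) / 2 + m)) z * v z := by
    rw [← integral_const_mul]
    refine setIntegral_congr_fun measurableSet_ball fun z hz => ?_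
    rw [inner_eq z hz]
    ring
  rw [ibp, ← integral_add_compl (measurableSet_ball (x := (0 : E)) (ε := 1)) hi2, inner] at lower
  linarith

theorem tendsto_norm_pow_mul_bubble {m : ℕ} (hm : 1 ≤ m) :
    Tendsto (fun x : E => ‖x‖ ^ N * bubble 1 (-((N : ℝ) / 2 + m)) x)
      (Bornology.cobounded E) (𝓝 0) := by
  have h1 : Tendsto (fun x : E => (‖x‖ ^ (2 * m))⁻¹) (Bornology.cobounded E) (𝓝 0) :=
    (tendsto_inv_atTop_zero.comp (tendsto_pow_atTop (by omega))).comp tendsto_norm_cobounded_atTop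
  refine tendsto_of_tendsto_of_tendsto_of_le_of_le' tendsto_const_nhds h1
    (Eventually.of_forall fun x => mul_nonneg (by positivity) (bubble_pos one_pos _ x).le) ?_
  filter_upwards [tendsto_norm_cobounded_atTop.eventually_gt_atTop 0] with x hx
  have h2 : bubble 1 (-((N : ℝ) / 2 + m)) x ≤ (‖x‖ ^ 2) ^ (-((N : ℝ) / 2 + m)) :=
    Real.rpow_le_rpow_of_nonpos (by positivity) (by linarith)
      (by have : (0 : ℝ) ≤ (N : ℝ) / 2 + m := by positivity
          linarith)
  have h3 : (‖x‖ ^ 2) ^ (-((N : ℝ) / 2 + m)) = (‖x‖ ^ N)⁻¹ * (‖x‖ ^ (2 * m))⁻¹ := by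
    rw [← Real.rpow_natCast, ← Real.rpow_mul hx.le, ← mul_inv, ← pow_add, ← Real.rpow_natCast,
      ← Real.rpow_neg hx.le]
    congr 1
    push_cast
    ring
  calc ‖x‖ ^ N * bubble 1 (-((N : ℝ) / 2 + m)) x
      ≤ ‖x‖ ^ N * ((‖x‖ ^ N)⁻¹ * (‖x‖ ^ (2 * m))⁻¹) :=
        mul_le_mul_of_nonneg_left (h3 ▸ h2) (by positivity)
    _ = (‖x‖ ^ (2 * m))⁻¹ := by field_simp

theorem bubble_inv {m : ℕ} {c : ℝ} (hc : 0 < c) (z : E) :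
    c⁻¹ ^ (2 * m) * bubble c⁻¹ (-((N : ℝ) / 2 + m)) z =
      c ^ N * bubble 1 (-((N : ℝ) / 2 + m)) (c • z) := by
  have h1 : c⁻¹ ^ 2 + ‖z‖ ^ 2 = (c ^ 2)⁻¹ * (1 ^ 2 + ‖c • z‖ ^ 2) := by
    rw [norm_smul, Real.norm_eq_abs, mul_pow, sq_abs]
    field_simp
  have h2 : ((c ^ 2)⁻¹) ^ (-((N : ℝ) / 2 + m)) = c ^ (2 * m) * c ^ N := by
    rw [Real.inv_rpow (by positivity), Real.rpow_neg (by positivity), inv_inv,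
      ← Real.rpow_natCast c 2, ← Real.rpow_mul hc.le, ← pow_add, ← Real.rpow_natCast]
    congr 1
    push_cast
    ring
  rw [bubble, bubble, h1, Real.mul_rpow (by positivity) (by positivity), h2, inv_pow]
  field_simp

theorem integrable_bubble_one {m : ℕ} (hm : 1 ≤ m) :
    Integrable (bubble 1 (-((N : ℝ) / 2 + m)) : E → ℝ) := by
  have h := integrable_rpow_neg_one_add_norm_sq (μ := (volume : Measure E)) (r := N + 2 * m)
    (by have : (1 : ℝ) ≤ m := by exact_mod_cast hm
        simp; linarith)
  have e : (bubble 1 (-((N : ℝ) / 2 + m)) : E → ℝ) =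
      fun x => (1 + ‖x‖ ^ 2) ^ (-((N : ℝ) + 2 * m) / 2) := by
    funext x
    rw [bubble, one_pow]
    congr 1
    ring
  rwa [e]

theorem tendsto_setIntegral_bubble {m : ℕ} (hm : 1 ≤ m) {v : E → ℝ} (hv : Continuous v) :
    Tendsto (fun c : ℝ => ∫ z in ball 0 1, c⁻¹ ^ (2 * m) *
      bubble c⁻¹ (-((N : ℝ) / 2 + m)) z * v z) atTop
      (𝓝 ((∫ z : E, bubble 1 (-((N : ℝ) / 2 + m)) z) * v 0)) := by
  set k : E → ℝ := bubble 1 (-((N : ℝ) / 2 + m)) with hk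
  set I : ℝ := ∫ z, k z with hI
  have hkpos : ∀ z, 0 < k z := bubble_pos one_pos _
  have hIpos : 0 < I := by
    have hc : Continuous k := (contDiff_bubble one_pos _).continuous
    refine integral_pos_of_integrable_nonneg_nonzero (x := 0) hc (integrable_bubble_one hm)
      (fun z => (hkpos z).le) (hkpos 0).ne'
  have hg : Integrable ((ball (0 : E) 1).indicator v) :=
    ((integrableOn_closedBall_of_continuous hv 0 1).mono_set
      ball_subset_closedBall).integrable_indicator measurableSet_ball
  have hg0 : ContinuousAt ((ball (0 : E) 1).indicator v) 0 := by
    refine hv.continuousAt.congr ?_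
    filter_upwards [isOpen_ball.mem_nhds (mem_ball_self (x := (0 : E)) one_pos)] with z hz
    rw [Set.indicator_of_mem hz]
  have key := tendsto_integral_comp_smul_smul_of_integrable (μ := volume) (φ := fun z => I⁻¹ * k z)
    (fun z => mul_nonneg (inv_nonneg.2 hIpos.le) (hkpos z).le)
    (by rw [integral_const_mul, inv_mul_cancel₀ hIpos.ne'])
    (by
      have := (tendsto_norm_pow_mul_bubble (N := N) hm).const_mul I⁻¹
      rw [mul_zero] at this
      refine this.congr fun x => ?_
      rw [finrank_euclideanSpace, Fintype.card_fin]
      ring) hg hg0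
  have key2 := key.const_mul I
  rw [Set.indicator_of_mem (mem_ball_self one_pos)] at key2
  refine key2.congr' ?_
  filter_upwards [eventually_gt_atTop 0] with c hc
  rw [← integral_const_mul, ← integral_indicator measurableSet_ball]
  congr 1
  funext z
  by_cases hz : z ∈ ball (0 : E) 1
  · rw [Set.indicator_of_mem hz, Set.indicator_of_mem hz, bubble_inv hc, ← hk, finrank_euclideanSpace,
      Fintype.card_fin, smul_eq_mul]
    field_simp
  · simp [Set.indicator_of_notMem hz]

theorem exists_setIntegral_negLapPow_le {m : ℕ} (hm : 1 ≤ m) (hN : 2 * m < N) :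
    ∃ A C : ℝ, 0 < A ∧ 0 ≤ C ∧ ∀ v : E → ℝ, ContDiff ℝ (2 * m) v → (∀ x, 0 ≤ v x) →
      (∀ x, 0 ≤ negLapPow m v x) → ∀ r : ℝ, 0 < r → r ≤ 1 →
      (2 * r ^ 2) ^ (-((N : ℝ) / 2 - m)) * ∫ z in ball 0 r, negLapPow m v z ≤
        A * v 0 + C * ∫ z in closedBall 0 2 \ ball 0 1, v z := by
  obtain ⟨C, hC0, hC⟩ := exists_setIntegral_negLapPow_le_bubble hN
  have hI : 0 ≤ ∫ z : E, bubble 1 (-((N : ℝ) / 2 + m)) z :=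
    integral_nonneg fun z => (bubble_pos one_pos _ z).le
  have hA : 0 ≤ bubbleConst N m * ∫ z : E, bubble 1 (-((N : ℝ) / 2 + m)) z :=
    mul_nonneg (bubbleConst_pos hN).le hI
  refine ⟨bubbleConst N m * (∫ z : E, bubble 1 (-((N : ℝ) / 2 + m)) z) + 1, C, by positivity, hC0,
    fun v hv hv0 hmu r hr hr1 => ?_⟩
  have lim := ((tendsto_setIntegral_bubble hm hv.continuous).const_mul
    (bubbleConst N m)).add_const (C * ∫ z in closedBall 0 2 \ ball 0 1, v z)
  have h := ge_of_tendsto lim (b := (2 * r ^ 2) ^ (-((N : ℝ) / 2 - m)) *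
    ∫ z in ball 0 r, negLapPow m v z) ?_
  · nlinarith [hv0 0]
  · filter_upwards [eventually_ge_atTop r⁻¹, eventually_gt_atTop 0] with c hc hc0
    exact hC v hv hv0 hmu r c⁻¹ (inv_pos.2 hc0) (inv_le_of_inv_le₀ hr hc) hr1

theorem setIntegral_comp_add_smul (f : E → ℝ) (x : E) {ρ : ℝ} (hρ : 0 < ρ) {T : Set E}
    (hT : MeasurableSet T) :
    ∫ z in {z | x + ρ • z ∈ T}, f (x + ρ • z) = (ρ ^ N)⁻¹ * ∫ y in T, f y := by
  have hm : MeasurableSet {z : E | x + ρ • z ∈ T} :=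
    (by fun_prop : Measurable fun z : E => x + ρ • z) hT
  rw [← integral_indicator hm, ← integral_indicator hT]
  have h := Measure.integral_comp_smul volume (fun y => T.indicator f (x + y)) ρ
  rw [integral_add_left_eq_self (T.indicator f) x, finrank_euclideanSpace, Fintype.card_fin,
    abs_of_pos (by positivity), smul_eq_mul] at h
  rw [← h]
  rfl

theorem exists_const_mul_setIntegral_negLapPow_le {m : ℕ} (hm : 1 ≤ m) (hN : 2 * m < N) :
    ∃ c : ℝ, 0 < c ∧ ∀ u : E → ℝ, ContDiff ℝ (2 * m) u → (∀ x, 0 ≤ u x) →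
      (∀ x, 0 ≤ negLapPow m u x) → ∀ x : E,
      Tendsto (fun ρ : ℝ => (ρ ^ N)⁻¹ * ∫ y in closedBall x (2 * ρ) \ ball x ρ, u y) atTop (𝓝 0) →
      ∀ R : ℝ, 0 < R →
      c * R ^ (-((N : ℝ) - 2 * m)) * ∫ y in ball x R, negLapPow m u y ≤ u x := by
  obtain ⟨A, C, hA, hC0, hC⟩ := exists_setIntegral_negLapPow_le hm hN
  refine ⟨A⁻¹ * 2 ^ (-((N : ℝ) / 2 - m)), by positivity, fun u hu hu0 hmu x hlim R hR => ?_⟩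
  suffices h : 2 ^ (-((N : ℝ) / 2 - m)) * R ^ (-((N : ℝ) - 2 * m)) *
      ∫ y in ball x R, negLapPow m u y ≤ A * u x by
    rw [mul_assoc, mul_assoc, inv_mul_le_iff₀ hA, ← mul_assoc]
    exact h
  have lim := (hlim.const_mul C).const_add (A * u x)
  rw [mul_zero, add_zero] at lim
  refine ge_of_tendsto lim ?_
  filter_upwards [eventually_ge_atTop R] with ρ hρR
  have hρ : 0 < ρ := hR.trans_le hρR
  set v : E → ℝ := fun z => u (x + ρ • z) with hv
  have hvs : ContDiff ℝ (2 * m) v :=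
    hu.comp (contDiff_const.add (contDiff_id.const_smul ρ))
  have hnl : ∀ z, negLapPow m v z = ρ ^ (2 * m) * negLapPow m u (x + ρ • z) :=
    negLapPow_comp_add_smul u x ρ m
  have h := hC v hvs (fun z => hu0 _) (fun z => by rw [hnl]; exact mul_nonneg (by positivity) (hmu _))
    (R / ρ) (by positivity) ((div_le_one hρ).2 hρR)
  have dist_eq : ∀ z : E, dist (x + ρ • z) x = ρ * ‖z‖ := fun z => by
    rw [dist_eq_norm, add_sub_cancel_left, norm_smul, Real.norm_of_nonneg hρ.le]
  have s1 : ball (0 : E) (R / ρ) = {z | x + ρ • z ∈ ball x R} := by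
    ext z
    rw [Set.mem_ofPred_eq, mem_ball, mem_ball, dist_eq, dist_zero_right, lt_div_iff₀ hρ, mul_comm]
  have s2 : closedBall (0 : E) 2 \ ball 0 1 =
      {z | x + ρ • z ∈ closedBall x (2 * ρ) \ ball x ρ} := by
    ext z
    rw [Set.mem_ofPred_eq, Set.mem_sdiff, Set.mem_sdiff, mem_ball, mem_ball, mem_closedBall,
      mem_closedBall, dist_eq, dist_zero_right, mul_comm 2 ρ, mul_le_mul_iff_right₀ hρ,
      mul_lt_iff_lt_one_right hρ]
  simp only [hnl] at h
  rw [integral_const_mul, s1, s2, setIntegral_comp_add_smul (negLapPow m u) x hρ measurableSet_ball,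
    setIntegral_comp_add_smul u x hρ (measurableSet_closedBall.diff measurableSet_ball)] at h
  have e0 : v 0 = u x := by simp [hv]
  rw [e0] at h
  refine le_trans (le_of_eq ?_) h
  have e1 : (2 * (R / ρ) ^ 2) ^ (-((N : ℝ) / 2 - m)) =
      2 ^ (-((N : ℝ) / 2 - m)) * R ^ (-((N : ℝ) - 2 * m)) * (ρ ^ N * (ρ ^ (2 * m))⁻¹) := by
    rw [Real.mul_rpow (by norm_num) (by positivity), ← Real.rpow_natCast (R / ρ) 2,
      ← Real.rpow_mul (by positivity), Real.div_rpow hR.le hρ.le,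
      show ((2 : ℕ) : ℝ) * -((N : ℝ) / 2 - m) = -((N : ℝ) - 2 * m) by push_cast; ring,
      Real.rpow_neg hρ.le, div_inv_eq_mul, Real.rpow_sub hρ, Real.rpow_natCast,
      show (2 * m : ℝ) = ((2 * m : ℕ) : ℝ) by push_cast; ring, Real.rpow_natCast]
    ring
  rw [e1]
  field_simp

end LowerBound

section Convolution

open scoped Topology

variable {N : ℕ}

local notation "E" => EuclideanSpace ℝ (Fin N)

theorem volume_real_ball (hN : 1 ≤ N) (x : E) {r : ℝ} (hr : 0 ≤ r) :
    volume.real (ball x r) = r ^ N * volume.real (ball (0 : E) 1) := by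
  have : Nonempty (Fin N) := ⟨⟨0, hN⟩⟩
  rw [measureReal_def, Measure.addHaar_ball _ _ hr, finrank_euclideanSpace, Fintype.card_fin,
    ENNReal.toReal_mul, ENNReal.toReal_ofReal (by positivity), measureReal_def]

theorem volume_real_ball_pos (x : E) {r : ℝ} (hr : 0 < r) : 0 < volume.real (ball x r) :=
  ENNReal.toReal_pos (measure_ball_pos _ _ hr).ne' measure_ball_lt_top.ne

theorem tendsto_average_annulus {p : ℝ} (hp : 1 ≤ p) {Ψ : ℝ → ℝ} (hK : CondK N Ψ)
    {u : E → ℝ} (hu : Continuous u) (hu0 : ∀ x, 0 ≤ u x)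
    (hint : IntegrableOn (fun y : E => u y ^ p * Ψ (‖y‖ / 2)) {y : E | 1 < ‖y‖}) (x : E) :
    Tendsto (fun ρ : ℝ => (ρ ^ N)⁻¹ * ∫ y in closedBall x (2 * ρ) \ ball x ρ, u y)
      atTop (𝓝 0) := by
  set ω : ℝ := volume.real (ball (0 : E) 1) with hω
  have hω0 : 0 ≤ ω := measureReal_nonneg
  set J : ℝ := ∫ y in {y : E | 1 < ‖y‖}, u y ^ p * Ψ (‖y‖ / 2) with hJ
  have mext : MeasurableSet {y : E | 1 < ‖y‖} := measurableSet_lt measurable_const measurable_norm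
  have hvol : ∀ ρ : ℝ, 0 < ρ → volume.real (closedBall x (2 * ρ)) = 2 ^ N * ω * ρ ^ N := by
    intro ρ hρ
    rw [measureReal_def, Measure.addHaar_closedBall _ _ (by positivity), finrank_euclideanSpace,
      Fintype.card_fin, ENNReal.toReal_mul, ENNReal.toReal_ofReal (by positivity), hω,
      measureReal_def]
    ring
  have bound : ∀ η : ℝ, 0 < η → ∀ ρ : ℝ, ‖x‖ + 1 < ρ →
      (ρ ^ N)⁻¹ * ∫ y in closedBall x (2 * ρ) \ ball x ρ, u y ≤
        2 ^ N * ω * η + η ^ (1 - p) * J * 2 ^ N * ((2 * ρ) ^ N * Ψ (2 * ρ))⁻¹ := by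
    intro η hη ρ hρ
    have hx0 := norm_nonneg x
    have hρ0 : 0 < ρ := by linarith
    have hΨ : 0 < Ψ (2 * ρ) := hK.pos _ (by positivity)
    have mann : MeasurableSet (closedBall x (2 * ρ) \ ball x ρ) :=
      measurableSet_closedBall.diff measurableSet_ball
    have hsub : closedBall x (2 * ρ) \ ball x ρ ⊆ {y : E | 1 < ‖y‖} := by
      intro y hy
      have h1 : ρ ≤ dist y x := by simpa using hy.2
      have h2 : dist y x ≤ ‖y‖ + ‖x‖ := by rw [dist_eq_norm]; exact norm_sub_le _ _
      show 1 < ‖y‖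
      linarith
    have i1 : IntegrableOn (fun y => η ^ (1 - p) * (Ψ (2 * ρ))⁻¹ * (u y ^ p * Ψ (‖y‖ / 2)))
        (closedBall x (2 * ρ) \ ball x ρ) := (hint.mono_set hsub).const_mul _
    have i2 : IntegrableOn (fun _ : E => η) (closedBall x (2 * ρ) \ ball x ρ) :=
      (integrableOn_const (measure_closedBall_lt_top.ne)).mono_set Set.sdiff_subset
    have step : ∫ y in closedBall x (2 * ρ) \ ball x ρ, u y ≤
        ∫ y in closedBall x (2 * ρ) \ ball x ρ,
          (η + η ^ (1 - p) * (Ψ (2 * ρ))⁻¹ * (u y ^ p * Ψ (‖y‖ / 2))) := by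
      refine setIntegral_mono_on ((integrableOn_closedBall_of_continuous hu x (2 * ρ)).mono_set
        Set.sdiff_subset) (i2.add i1) mann fun y hy => ?_
      have hy1 : 1 < ‖y‖ := hsub hy
      have hyle : ‖y‖ / 2 ≤ 2 * ρ := by
        have h1 : dist y x ≤ 2 * ρ := hy.1
        have h2 : ‖y‖ ≤ dist y x + ‖x‖ := by
          rw [dist_eq_norm]; simpa using norm_add_le (y - x) x
        linarith
      have hΨle : Ψ (2 * ρ) ≤ Ψ (‖y‖ / 2) :=
        hK.anti (Set.mem_Ioi.2 (by linarith)) (Set.mem_Ioi.2 (by linarith)) hyle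
      have h3 : 1 ≤ (Ψ (2 * ρ))⁻¹ * Ψ (‖y‖ / 2) := by
        rw [← div_eq_inv_mul, one_le_div hΨ]; exact hΨle
      have h4 : 0 ≤ η ^ (1 - p) * u y ^ p :=
        mul_nonneg (Real.rpow_nonneg hη.le _) (Real.rpow_nonneg (hu0 y) _)
      have h5 : u y ≤ η + η ^ (1 - p) * u y ^ p := by
        rcases le_total (u y) η with h | h
        · linarith
        · have hu1 : 0 < u y := hη.trans_le h
          have h6 : u y ^ (1 - p) ≤ η ^ (1 - p) :=
            Real.rpow_le_rpow_of_nonpos hη h (by linarith)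
          have h7 : u y ^ (1 - p) * u y ^ p = u y := by
            rw [← Real.rpow_add hu1]; simp
          have h8 := mul_le_mul_of_nonneg_right h6 (Real.rpow_nonneg hu1.le p)
          linarith
      nlinarith [mul_le_mul_of_nonneg_left h3 h4]
    rw [integral_add i2 i1, integral_const_mul, setIntegral_const, smul_eq_mul] at step
    have s1 : volume.real (closedBall x (2 * ρ) \ ball x ρ) ≤ 2 ^ N * ω * ρ ^ N := by
      rw [← hvol ρ hρ0]
      exact measureReal_mono Set.sdiff_subset measure_closedBall_lt_top.ne
    have s2 : ∫ y in closedBall x (2 * ρ) \ ball x ρ, u y ^ p * Ψ (‖y‖ / 2) ≤ J := by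
      refine setIntegral_mono_set hint ?_ hsub.eventuallyLE
      refine (ae_restrict_iff' mext).2 (Eventually.of_forall fun y hy => ?_)
      have hy1 : 1 < ‖y‖ := hy
      exact mul_nonneg (Real.rpow_nonneg (hu0 y) _) (hK.pos _ (by linarith)).le
    have s3 : 0 ≤ η ^ (1 - p) * (Ψ (2 * ρ))⁻¹ :=
      mul_nonneg (Real.rpow_nonneg hη.le _) (inv_nonneg.2 hΨ.le)
    have total : ∫ y in closedBall x (2 * ρ) \ ball x ρ, u y ≤
        2 ^ N * ω * ρ ^ N * η + η ^ (1 - p) * (Ψ (2 * ρ))⁻¹ * J :=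
      step.trans (add_le_add (mul_le_mul_of_nonneg_right s1 hη.le)
        (mul_le_mul_of_nonneg_left s2 s3))
    refine (mul_le_mul_of_nonneg_left total (by positivity)).trans (le_of_eq ?_)
    rw [mul_pow]
    field_simp
  have lim2 : Tendsto (fun ρ : ℝ => ((2 * ρ) ^ N * Ψ (2 * ρ))⁻¹) atTop (𝓝 0) :=
    tendsto_inv_atTop_zero.comp
      (hK.tendsto.comp (tendsto_id.const_mul_atTop (by norm_num : (0 : ℝ) < 2)))
  rw [Metric.tendsto_atTop']
  intro ε hε
  set η : ℝ := ε / (2 * (2 ^ N * ω + 1)) with hη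
  have hη0 : 0 < η := by positivity
  have hηle : 2 ^ N * ω * η < ε / 2 := by
    rw [hη, ← mul_div_assoc, div_lt_div_iff₀ (by positivity) (by norm_num)]
    nlinarith
  have lim3 := lim2.const_mul (η ^ (1 - p) * J * 2 ^ N)
  rw [mul_zero] at lim3
  have ev := (lim3.eventually_lt_const (half_pos hε)).and (eventually_gt_atTop (‖x‖ + 1))
  obtain ⟨M, hM⟩ := eventually_atTop.1 ev
  refine ⟨M, fun ρ hρ => ?_⟩
  obtain ⟨h1, h2⟩ := hM ρ hρ.le
  have h0 : 0 ≤ (ρ ^ N)⁻¹ * ∫ y in closedBall x (2 * ρ) \ ball x ρ, u y :=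
    mul_nonneg (inv_nonneg.2 (pow_nonneg (by linarith [norm_nonneg x]) _))
      (integral_nonneg fun y => hu0 y)
  rw [Real.dist_eq, sub_zero, abs_of_nonneg h0]
  linarith [bound η hη0 ρ h2]

theorem integrable_rpow_mul_kernel {p : ℝ} (hp : 0 ≤ p) {Ψ : ℝ → ℝ} (hK : CondK N Ψ)
    {u : E → ℝ} (hu : Continuous u) (hu0 : ∀ x, 0 ≤ u x)
    (hint : IntegrableOn (fun y : E => u y ^ p * Ψ (‖y‖ / 2)) {y : E | 1 < ‖y‖}) (x : E) :
    Integrable (fun y : E => u y ^ p * Ψ ‖y - x‖) := by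
  have hx0 := norm_nonneg x
  have hup : Continuous fun y => u y ^ p := hu.rpow_const fun y => Or.inr hp
  have hmeas : AEStronglyMeasurable (fun y : E => Ψ ‖y - x‖) volume :=
    hK.locInt.aestronglyMeasurable.comp_measurePreserving (measurePreserving_sub_right volume x)
  set R : ℝ := 2 * ‖x‖ + 1 with hR
  have near : IntegrableOn (fun y : E => u y ^ p * Ψ ‖y - x‖) (closedBall 0 R) := by
    refine IntegrableOn.continuousOn_mul hup.continuousOn ?_ (isCompact_closedBall 0 R)
    have h1 : IntegrableOn (fun y : E => Ψ ‖y‖) (closedBall 0 (R + ‖x‖)) :=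
      hK.locInt.integrableOn_isCompact (isCompact_closedBall _ _)
    have h2 := ((integrable_indicator_iff measurableSet_closedBall).2 h1).comp_sub_right x
    refine (h2.integrableOn (s := closedBall 0 R)).congr_fun (fun y hy => ?_)
      measurableSet_closedBall
    have hy1 : ‖y‖ ≤ R := by simpa using hy
    have hy2 : y - x ∈ closedBall (0 : E) (R + ‖x‖) := by
      rw [mem_closedBall, dist_zero_right]
      exact (norm_sub_le _ _).trans (by linarith)
    exact Set.indicator_of_mem hy2 _
  have far : IntegrableOn (fun y : E => u y ^ p * Ψ ‖y - x‖) (closedBall 0 R)ᶜ := by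
    have hmem : ∀ y ∈ (closedBall (0 : E) R)ᶜ, R < ‖y‖ := fun y hy => by simpa using hy
    refine Integrable.mono' (hint.mono_set fun y hy => ?_)
      (hup.aestronglyMeasurable.mul hmeas).restrict ?_
    · have := hmem y hy
      show 1 < ‖y‖
      linarith
    · refine (ae_restrict_iff' measurableSet_closedBall.compl).2 (Eventually.of_forall fun y hy => ?_)
      have h1 := hmem y hy
      have h2 : ‖y‖ - ‖x‖ ≤ ‖y - x‖ := norm_sub_norm_le y x
      have h3 : 0 < Ψ ‖y - x‖ := hK.pos _ (by linarith)
      rw [norm_mul, Real.norm_of_nonneg h3.le, Real.norm_of_nonneg (Real.rpow_nonneg (hu0 y) p)]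
      refine mul_le_mul_of_nonneg_left ?_ (Real.rpow_nonneg (hu0 y) p)
      exact hK.anti (Set.mem_Ioi.2 (by linarith)) (Set.mem_Ioi.2 (by linarith)) (by linarith)
  rw [← integrableOn_univ, ← Set.union_compl_self (closedBall (0 : E) R)]
  exact near.union far

theorem ae_ne_point (hN : 1 ≤ N) (x : E) : ∀ᵐ y : E, y ≠ x := by
  have : Nonempty (Fin N) := ⟨⟨0, hN⟩⟩
  exact compl_mem_ae_iff.2 (measure_singleton x)

theorem ae_rpow_mul_kernel_nonneg (hN : 1 ≤ N) {p : ℝ} {Ψ : ℝ → ℝ} (hK : CondK N Ψ)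
    {u : E → ℝ} (hu0 : ∀ x, 0 ≤ u x) (x : E) : ∀ᵐ y : E, 0 ≤ u y ^ p * Ψ ‖y - x‖ := by
  filter_upwards [ae_ne_point hN x] with y hy
  exact mul_nonneg (Real.rpow_nonneg (hu0 y) p) (hK.pos _ (norm_pos_iff.2 (sub_ne_zero.2 hy))).le

theorem const_mul_le_setIntegral (hN : 1 ≤ N) {p q : ℝ} (hp : 0 ≤ p) (hq : 0 ≤ q) {Ψ : ℝ → ℝ}
    (hK : CondK N Ψ) {u f : E → ℝ} (hu0 : ∀ x, 0 ≤ u x)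
    (hint : ∀ x, Integrable (fun y : E => u y ^ p * Ψ ‖y - x‖)) (hf : Continuous f)
    (hle : ∀ x, (∫ y, u y ^ p * Ψ ‖y - x‖) * u x ^ q ≤ f x) {z : E} {R t : ℝ} (ht : 0 ≤ t)
    (hut : ∀ x ∈ ball z R, t ≤ u x) {S : Set E} (hS : MeasurableSet S) (hSR : S ⊆ ball z R) :
    volume.real S * volume.real (ball z R) * t ^ (p + q) * Ψ (2 * R) ≤ ∫ x in S, f x := by
  have pt : ∀ x ∈ ball z R, volume.real (ball z R) * t ^ (p + q) * Ψ (2 * R) ≤ f x := by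
    intro x hx
    have hR : 0 < R := pos_of_mem_ball hx
    have hΨ : 0 < Ψ (2 * R) := hK.pos _ (by positivity)
    have h1 : volume.real (ball z R) * (t ^ p * Ψ (2 * R)) ≤ ∫ y, u y ^ p * Ψ ‖y - x‖ := by
      refine le_trans ?_ (setIntegral_le_integral (s := ball z R) (hint x)
        (ae_rpow_mul_kernel_nonneg hN hK hu0 x))
      rw [← smul_eq_mul, ← setIntegral_const]
      refine setIntegral_mono_on_ae (integrableOn_const measure_ball_lt_top.ne)
        (hint x).integrableOn measurableSet_ball ?_
      filter_upwards [ae_ne_point hN x] with y hyx hy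
      have hpos : 0 < ‖y - x‖ := norm_pos_iff.2 (sub_ne_zero.2 hyx)
      have hdist : ‖y - x‖ ≤ 2 * R := by
        rw [← dist_eq_norm]
        have := dist_triangle_right y x z
        have h2 : dist y z < R := hy
        have h3 : dist x z < R := hx
        linarith
      exact mul_le_mul (Real.rpow_le_rpow ht (hut y hy) hp)
        (hK.anti (Set.mem_Ioi.2 hpos) (Set.mem_Ioi.2 (by positivity)) hdist) hΨ.le
        (Real.rpow_nonneg (hu0 y) p)
    refine le_trans ?_ (hle x)
    calc volume.real (ball z R) * t ^ (p + q) * Ψ (2 * R)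
        = volume.real (ball z R) * (t ^ p * Ψ (2 * R)) * t ^ q := by
          rw [Real.rpow_add_of_nonneg ht hp hq]; ring
      _ ≤ (∫ y, u y ^ p * Ψ ‖y - x‖) * u x ^ q := by
          refine mul_le_mul h1 (Real.rpow_le_rpow ht (hut x hx) hq) (Real.rpow_nonneg ht q) ?_
          exact integral_nonneg_of_ae (ae_rpow_mul_kernel_nonneg hN hK hu0 x)
  have hSfin : volume S ≠ ⊤ := ((measure_mono hSR).trans_lt measure_ball_lt_top).ne
  rw [mul_assoc, mul_assoc, ← mul_assoc (volume.real (ball z R)), ← smul_eq_mul (volume.real S),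
    ← setIntegral_const]
  exact setIntegral_mono_on (integrableOn_const hSfin)
    ((integrableOn_closedBall_of_continuous hf z R).mono_set (hSR.trans ball_subset_closedBall)) hS
    fun x hx => pt x (hSR hx)

end Convolution

section Liouville

open scoped Topology

variable {N : ℕ}

local notation "E" => EuclideanSpace ℝ (Fin N)

theorem const_mul_rpow_le_setIntegral (hN : 1 ≤ N) {p q : ℝ} (hp : 0 ≤ p) (hq : 0 ≤ q) {Ψ : ℝ → ℝ}
    (hK : CondK N Ψ) {u f : E → ℝ} (hu0 : ∀ x, 0 ≤ u x)
    (hint : ∀ x, Integrable (fun y : E => u y ^ p * Ψ ‖y - x‖)) (hf : Continuous f)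
    (hle : ∀ x, (∫ y, u y ^ p * Ψ ‖y - x‖) * u x ^ q ≤ f x) {b c r a : ℝ} (hr : 0 < r)
    (hc : c ≤ r ^ (2 * (N : ℝ) - b * (p + q)) * Ψ r) (ha : 0 ≤ a)
    (hua : ∀ x ∈ ball (0 : E) (r / 2), a * r ^ (-b) ≤ u x) {S : Set E} (hS : MeasurableSet S)
    (hSr : S ⊆ ball 0 (r / 2))
    (hvol : volume.real (ball (0 : E) (r / 2)) ≤ 2 * volume.real S) :
    2⁻¹ * (volume.real (ball (0 : E) 1) / 2 ^ N) ^ 2 * c * a ^ (p + q) ≤ ∫ x in S, f x := by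
  have h := const_mul_le_setIntegral hN hp hq hK hu0 hint hf hle (by positivity) hua hS hSr
  refine le_trans ?_ h
  set ω := volume.real (ball (0 : E) 1) with hω
  have hω0 : 0 ≤ ω := measureReal_nonneg
  have hΨ : 0 < Ψ r := hK.pos r hr
  have hV : volume.real (ball (0 : E) (r / 2)) = r ^ N * (ω / 2 ^ N) := by
    rw [volume_real_ball hN _ (by positivity), div_pow]; ring
  have hpow : (r ^ N) ^ 2 * (r ^ (-b)) ^ (p + q) = r ^ (2 * (N : ℝ) - b * (p + q)) := by
    rw [← Real.rpow_mul hr.le, ← pow_mul, ← Real.rpow_natCast, ← Real.rpow_add hr]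
    congr 1; push_cast; ring
  rw [Real.mul_rpow ha (by positivity), show 2 * (r / 2) = r by ring]
  calc 2⁻¹ * (ω / 2 ^ N) ^ 2 * c * a ^ (p + q)
      ≤ 2⁻¹ * (ω / 2 ^ N) ^ 2 * (r ^ (2 * (N : ℝ) - b * (p + q)) * Ψ r) * a ^ (p + q) := by
        gcongr
    _ = 2⁻¹ * (r ^ N * (ω / 2 ^ N)) * (r ^ N * (ω / 2 ^ N)) *
          (a ^ (p + q) * (r ^ (-b)) ^ (p + q)) * Ψ r := by rw [← hpow]; ring
    _ ≤ _ := by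
        rw [← hV]
        gcongr
        linarith

theorem volume_real_ball_le_two_mul_annulus (hN : 1 ≤ N) {r : ℝ} (hr : 0 < r) :
    volume.real (ball (0 : E) (r / 2)) ≤
      2 * volume.real (ball (0 : E) (r / 2) \ ball 0 (r / 4)) := by
  rw [measureReal_sdiff (ball_subset_ball (by linarith)) measurableSet_ball
    measure_ball_lt_top.ne, volume_real_ball hN _ (by positivity),
    volume_real_ball hN (0 : E) (r := r / 4) (by positivity)]
  have hω0 : 0 ≤ volume.real (ball (0 : E) 1) := measureReal_nonneg
  have h : 2 * (r / 4) ^ N ≤ (r / 2) ^ N := by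
    rw [show r / 4 = (r / 2) * 2⁻¹ by ring, mul_pow]
    have h2 : (2⁻¹ : ℝ) ^ N ≤ 2⁻¹ := pow_le_of_le_one (by norm_num) (by norm_num) (by omega)
    nlinarith [pow_pos (half_pos hr) N]
  nlinarith

theorem le_max_of_mutual_rpow_le {K c s t X Y : ℝ} (hK : 0 < K) (hc : 0 < c) (hs : 2 ≤ s)
    (ht : 2 ≤ t) (hX : K * (c * Y) ^ s ≤ X) (hY : K * (c * X) ^ t ≤ Y) :
    X ≤ max (1 / c) (1 / (K * c ^ 2)) := by
  by_contra! h
  obtain ⟨h1, h2⟩ := max_lt_iff.1 h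
  rw [div_lt_iff₀ hc] at h1
  rw [div_lt_iff₀ (by positivity)] at h2
  have hX0 : 0 < X := by by_contra! h0; nlinarith
  have e1 : (c * X) ^ (2 : ℝ) ≤ (c * X) ^ t :=
    Real.rpow_le_rpow_of_exponent_le (by linarith) ht
  rw [Real.rpow_two] at e1
  have hXY : X < Y := by nlinarith [mul_le_mul_of_nonneg_left e1 hK.le]
  have e2 : (c * Y) ^ (2 : ℝ) ≤ (c * Y) ^ s :=
    Real.rpow_le_rpow_of_exponent_le (by nlinarith) hs
  rw [Real.rpow_two] at e2
  have hYX : X * (K * c ^ 2) < Y * (K * c ^ 2) := by gcongr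
  nlinarith [mul_le_mul_of_nonneg_left e2 hK.le]

theorem setIntegral_ball_pos {f : E → ℝ} (hf : Continuous f) (hf0 : ∀ x, 0 ≤ f x) {p q : ℝ}
    (hN : 1 ≤ N) (hp : 0 ≤ p) (hq : 0 ≤ q) {Ψ : ℝ → ℝ} (hK : CondK N Ψ) {u : E → ℝ}
    (hu0 : ∀ x, 0 ≤ u x) (hint : ∀ x, Integrable (fun y : E => u y ^ p * Ψ ‖y - x‖))
    (hle : ∀ x, (∫ y, u y ^ p * Ψ ‖y - x‖) * u x ^ q ≤ f x) {z : E} {R t : ℝ} (hR : 0 < R)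
    (ht : 0 < t) (hut : ∀ x ∈ ball z R, t ≤ u x) {ρ : ℝ} (hρ : ball z R ⊆ ball 0 ρ) :
    0 < ∫ x in ball 0 ρ, f x := by
  have h := const_mul_le_setIntegral hN hp hq hK hu0 hint hf hle ht.le hut measurableSet_ball
    subset_rfl
  have hv := volume_real_ball_pos z hR
  have hΨ := hK.pos (2 * R) (by positivity)
  refine lt_of_lt_of_le (lt_of_lt_of_le (by positivity) h) ?_
  exact setIntegral_mono_set
    ((integrableOn_closedBall_of_continuous hf 0 ρ).mono_set ball_subset_closedBall)
    (Eventually.of_forall hf0) hρ.eventuallyLE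

theorem eq_zero_of_mutual_convolution_le (hN : 1 ≤ N) {p q p' q' b c c₀ : ℝ} (hp : 0 ≤ p)
    (hq : 0 ≤ q) (hp' : 0 ≤ p') (hq' : 0 ≤ q') (hpq : 2 ≤ p + q) (hpq' : 2 ≤ p' + q')
    (hc : 0 < c) (hc₀ : 0 < c₀) {Ψ Ψ' : ℝ → ℝ} (hK : CondK N Ψ) (hK' : CondK N Ψ')
    {u v f g : E → ℝ} (hv : Continuous v) (hu0 : ∀ x, 0 ≤ u x) (hv0 : ∀ x, 0 ≤ v x)
    (hf : Continuous f) (hg : Continuous g) (hf0 : ∀ x, 0 ≤ f x) (hg0 : ∀ x, 0 ≤ g x)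
    (hint : ∀ x, Integrable (fun y : E => v y ^ p * Ψ ‖y - x‖))
    (hint' : ∀ x, Integrable (fun y : E => u y ^ p' * Ψ' ‖y - x‖))
    (hle : ∀ x, (∫ y, v y ^ p * Ψ ‖y - x‖) * v x ^ q ≤ f x)
    (hle' : ∀ x, (∫ y, u y ^ p' * Ψ' ‖y - x‖) * u x ^ q' ≤ g x)
    (hfu : ∀ r, 0 < r → ∀ x ∈ ball (0 : E) (r / 2),
      c * (∫ y in ball 0 (r / 2), f y) * r ^ (-b) ≤ u x)
    (hgv : ∀ r, 0 < r → ∀ x ∈ ball (0 : E) (r / 2),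
      c * (∫ y in ball 0 (r / 2), g y) * r ^ (-b) ≤ v x)
    (hfreq : ∃ᶠ r : ℝ in atTop, c₀ ≤ min (r ^ (2 * (N : ℝ) - b * (p + q)) * Ψ r)
      (r ^ (2 * (N : ℝ) - b * (p' + q')) * Ψ' r)) (x : E) : v x = 0 := by
  have hintf : ∀ r, IntegrableOn f (ball (0 : E) r) := fun r =>
    (integrableOn_closedBall_of_continuous hf 0 r).mono_set ball_subset_closedBall
  have hintg : ∀ r, IntegrableOn g (ball (0 : E) r) := fun r =>
    (integrableOn_closedBall_of_continuous hg 0 r).mono_set ball_subset_closedBall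
  set F : ℝ → ℝ := fun r => ∫ y in ball (0 : E) r, f y with hF
  set G : ℝ → ℝ := fun r => ∫ y in ball (0 : E) r, g y with hG
  have hFm : Monotone F := fun r s h => setIntegral_mono_set (hintf s)
    (Eventually.of_forall hf0) (ball_subset_ball h).eventuallyLE
  have hGm : Monotone G := fun r s h => setIntegral_mono_set (hintg s)
    (Eventually.of_forall hg0) (ball_subset_ball h).eventuallyLE
  have hF0 : ∀ r, 0 ≤ F r := fun r => setIntegral_nonneg measurableSet_ball fun y _ => hf0 y
  have hG0 : ∀ r, 0 ≤ G r := fun r => setIntegral_nonneg measurableSet_ball fun y _ => hg0 y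
  set K : ℝ := 2⁻¹ * (volume.real (ball (0 : E) 1) / 2 ^ N) ^ 2 * c₀ with hKdef
  have hKpos : 0 < K := by
    have := volume_real_ball_pos (0 : E) one_pos
    positivity
  have hvol : ∀ r : ℝ, volume.real (ball (0 : E) (r / 2)) ≤
      2 * volume.real (ball (0 : E) (r / 2)) := fun r => by
    linarith [measureReal_nonneg (μ := volume) (s := ball (0 : E) (r / 2))]
  have hbdd : ∀ r, F r ≤ max (1 / c) (1 / (K * c ^ 2)) := by
    intro r
    obtain ⟨ρ, hρ, hρr⟩ := (hfreq.and_eventually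
      (eventually_ge_atTop (max 1 (2 * r)))).exists
    have hρ0 : 0 < ρ := lt_of_lt_of_le one_pos ((le_max_left _ _).trans hρr)
    have h1 : K * (c * G (ρ / 2)) ^ (p + q) ≤ F (ρ / 2) :=
      const_mul_rpow_le_setIntegral hN hp hq hK hv0 hint hf hle hρ0 (hρ.trans (min_le_left _ _))
        (mul_nonneg hc.le (hG0 _)) (hgv ρ hρ0) measurableSet_ball subset_rfl (hvol ρ)
    have h2 : K * (c * F (ρ / 2)) ^ (p' + q') ≤ G (ρ / 2) :=
      const_mul_rpow_le_setIntegral hN hp' hq' hK' hu0 hint' hg hle' hρ0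
        (hρ.trans (min_le_right _ _)) (mul_nonneg hc.le (hF0 _)) (hfu ρ hρ0) measurableSet_ball
        subset_rfl (hvol ρ)
    exact (hFm (by linarith [(le_max_right _ _).trans hρr])).trans
      (le_max_of_mutual_rpow_le hKpos hc hpq hpq' h1 h2)
  by_contra hx
  have hvx : 0 < v x := (hv0 x).lt_of_ne' hx
  obtain ⟨R, hR, hRv⟩ := Metric.eventually_nhds_iff_ball.1
    (hv.continuousAt.eventually (lt_mem_nhds (half_lt_self hvx)))
  set ρ := ‖x‖ + R with hρ
  have hρ0 : 0 < ρ := by positivity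
  have hsub : ball x R ⊆ ball 0 ρ := ball_subset_ball' (by rw [dist_zero_right, hρ, add_comm])
  have hFρ : 0 < F ρ := setIntegral_ball_pos hf hf0 hN hp hq hK hv0 hint hle hR
    (half_pos hvx) (fun y hy => (hRv y hy).le) hsub
  have hGρ : 0 < G ρ := by
    refine setIntegral_ball_pos hg hg0 hN hp' hq' hK' hu0 hint' hle' hρ0
      (t := c * F ρ * (2 * ρ) ^ (-b)) (by positivity) (fun y hy => ?_) subset_rfl
    have := hfu (2 * ρ) (by positivity) y
    rw [show 2 * ρ / 2 = ρ by ring] at this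
    exact this hy
  set d := K * (c * G ρ) ^ (p + q) with hd
  have hdpos : 0 < d := by positivity
  have hlim := tendsto_atTop_ciSup hFm ⟨_, Set.forall_mem_range.2 hbdd⟩
  have hdiff : Tendsto (fun r : ℝ => F (r / 2) - F (r / 4)) atTop (𝓝 0) := by
    simpa using (hlim.comp (tendsto_id.atTop_div_const (two_pos))).sub
      (hlim.comp (tendsto_id.atTop_div_const (four_pos)))
  obtain ⟨r, hr, hrρ, hrd⟩ := (hfreq.and_eventually
    ((eventually_ge_atTop (2 * ρ)).and (hdiff.eventually (gt_mem_nhds hdpos)))).exists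
  have hr0 : 0 < r := by linarith
  have hS : d ≤ ∫ y in ball (0 : E) (r / 2) \ ball 0 (r / 4), f y := by
    refine const_mul_rpow_le_setIntegral hN hp hq hK hv0 hint hf hle hr0
      (hr.trans (min_le_left _ _)) (by positivity) (fun y hy => ?_)
      (measurableSet_ball.diff measurableSet_ball) Set.sdiff_subset
      (volume_real_ball_le_two_mul_annulus hN hr0)
    refine le_trans ?_ (hgv r hr0 y hy)
    gcongr
    exact hGm (by linarith)
  rw [setIntegral_sdiff measurableSet_ball (hintf _) (ball_subset_ball (by linarith))] at hS
  exact absurd hrd (not_lt.2 hS)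

end Liouville

theorem stmt_8 (N m : ℕ) (hm : 1 ≤ m) (hN : 2 * m < N)
    (n : ℕ) (hn : 1 ≤ n)
    (e : Fin n → Fin n → ℝ)
    (he01 : ∀ i j, e i j = 0 ∨ e i j = 1)
    (hesymm : ∀ i j, e i j = e j i)
    (p q : Fin n → Fin n → ℝ)
    (hp : ∀ i j, 1 ≤ p i j) (hq : ∀ i j, 0 < q i j)
    (Ψ : Fin n → Fin n → ℝ → ℝ) (hK : ∀ i j, CondK N (Ψ i j))
    (u : Fin n → EuclideanSpace ℝ (Fin N) → ℝ)
    (hreg : ∀ j, ContDiff ℝ (2 * m) (u j))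
    (hpos : ∀ j x, 0 ≤ u j x)
    (hint : ∀ i j, IntegrableOn
      (fun y : EuclideanSpace ℝ (Fin N) => u j y ^ p i j * Ψ i j (‖y‖ / 2))
      {y : EuclideanSpace ℝ (Fin N) | 1 < ‖y‖})
    (hineq : ∀ i, ∀ x : EuclideanSpace ℝ (Fin N),
      (∑ j, e i j * ((∫ y : EuclideanSpace ℝ (Fin N), u j y ^ p i j * Ψ i j ‖y - x‖)
        * u j x ^ q i j)) ≤ negLapPow m (u i) x)
    (k l : Fin n) (hekl : e k l = 1) (helk : e l k = 1)
    (hpqkl : 2 ≤ p k l + q k l) (hpqlk : 2 ≤ p l k + q l k)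
    (hlimsup : ∃ c : ℝ, 0 < c ∧ ∃ᶠ r : ℝ in atTop,
      c ≤ min (r ^ (2 * (N : ℝ) - ((N : ℝ) - 2 * m) * (p k l + q k l)) * Ψ k l r)
              (r ^ (2 * (N : ℝ) - ((N : ℝ) - 2 * m) * (p l k + q l k)) * Ψ l k r)) :
    (∀ x, u k x = 0) ∧ (∀ x, u l x = 0) := by
  have hN1 : 1 ≤ N := by omega
  obtain ⟨c, hc, hlow⟩ := exists_const_mul_setIntegral_negLapPow_le hm hN
  obtain ⟨c₀, hc₀, hfreq⟩ := hlimsup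
  have hcont : ∀ i, Continuous (negLapPow m (u i)) := fun i => continuous_negLapPow (hreg i)
  have hkint : ∀ i j x, Integrable
      (fun y : EuclideanSpace ℝ (Fin N) => u j y ^ p i j * Ψ i j ‖y - x‖) := fun i j x =>
    integrable_rpow_mul_kernel (zero_le_one.trans (hp i j)) (hK i j) (hreg j).continuous (hpos j)
      (hint i j) x
  have hconv : ∀ i j x, 0 ≤ (∫ y : EuclideanSpace ℝ (Fin N), u j y ^ p i j * Ψ i j ‖y - x‖)
      * u j x ^ q i j := fun i j x =>
    mul_nonneg (integral_nonneg_of_ae (ae_rpow_mul_kernel_nonneg hN1 (hK i j) (hpos j) x))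
      (Real.rpow_nonneg (hpos j x) _)
  have hterm : ∀ i j x, 0 ≤ e i j * ((∫ y : EuclideanSpace ℝ (Fin N),
      u j y ^ p i j * Ψ i j ‖y - x‖) * u j x ^ q i j) := fun i j x =>
    mul_nonneg (by rcases he01 i j with h | h <;> simp [h]) (hconv i j x)
  have hnonneg : ∀ i x, 0 ≤ negLapPow m (u i) x := fun i x =>
    (Finset.sum_nonneg fun j _ => hterm i j x).trans (hineq i x)
  have hdom : ∀ i j, e i j = 1 → ∀ x, (∫ y : EuclideanSpace ℝ (Fin N),
      u j y ^ p i j * Ψ i j ‖y - x‖) * u j x ^ q i j ≤ negLapPow m (u i) x := by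
    intro i j hij x
    have h := Finset.single_le_sum (fun j _ => hterm i j x) (Finset.mem_univ j)
    rw [hij, one_mul] at h
    exact h.trans (hineq i x)
  have hbound : ∀ i r, 0 < r → ∀ x ∈ ball (0 : EuclideanSpace ℝ (Fin N)) (r / 2),
      c * (∫ y in ball 0 (r / 2), negLapPow m (u i) y) * r ^ (-((N : ℝ) - 2 * m)) ≤ u i x := by
    intro i r hr x hx
    refine le_trans ?_ (hlow (u i) (hreg i) (hpos i) (hnonneg i) x
      (tendsto_average_annulus (hp i i) (hK i i) (hreg i).continuous (hpos i) (hint i i) x) r hr)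
    rw [mul_right_comm]
    refine mul_le_mul_of_nonneg_left ?_ (by positivity)
    refine setIntegral_mono_set ((integrableOn_closedBall_of_continuous (hcont i) x r).mono_set
      ball_subset_closedBall) (Eventually.of_forall (hnonneg i)) (LE.le.eventuallyLE ?_)
    refine ball_subset_ball' ?_
    rw [mem_ball, dist_comm] at hx
    linarith
  have key : ∀ i j, e i j = 1 → e j i = 1 → 2 ≤ p i j + q i j → 2 ≤ p j i + q j i →
      (∃ᶠ r : ℝ in atTop,
        c₀ ≤ min (r ^ (2 * (N : ℝ) - ((N : ℝ) - 2 * m) * (p i j + q i j)) * Ψ i j r)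
          (r ^ (2 * (N : ℝ) - ((N : ℝ) - 2 * m) * (p j i + q j i)) * Ψ j i r)) →
      ∀ x, u j x = 0 := fun i j hij hji hs hs' hfr =>
    eq_zero_of_mutual_convolution_le hN1 (zero_le_one.trans (hp i j)) (hq i j).le
      (zero_le_one.trans (hp j i)) (hq j i).le hs hs' hc hc₀ (hK i j) (hK j i)
      (hreg j).continuous (hpos i) (hpos j) (hcont i) (hcont j) (hnonneg i) (hnonneg j)
      (hkint i j) (hkint j i) (hdom i j hij) (hdom j i hji) (hbound i) (hbound j) hfr
  refine ⟨key l k helk hekl hpqlk hpqkl ?_, key k l hekl helk hpqkl hpqlk hfreq⟩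
  simpa only [min_comm] using hfreq
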